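/- The coproduct Δ̃ of the output feedback Hopf algebra satisfies the identities: (1) Δ̃ a_∅ = a_∅ ⊗ 1; (2) Δ̃ ∘ θ_1 = (θ_1 ⊗ id) ∘ Δ̃; (3) Δ̃ ∘ θ_0 = (θ_0 ⊗ id) ∘ Δ̃ + (θ_1 ⊗ μ) ∘ (Δ̃ ⊗ id) ∘ Δ_⧢, where id is the identity map on H and μ is the product of H. -/

import Mathlib

open scoped TensorProduct

noncomputable section

namespace Paper

/-- Words over the alphabet `X = {x0, x1}`, encoded as lists over `Fin 2`
(`0` stands for the letter `x0` and `1` for the letter `x1`). -/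
abbrev Word : Type := List (Fin 2)

/-- Formal power series `ℝ⟨⟨X⟩⟩`, given by their coefficient functions `η ↦ ⟨c,η⟩`. -/
abbrev Series : Type := Word → ℝ

/-- The left shift `x_i⁻¹(c)`. -/
def lshift (i : Fin 2) (c : Series) : Series := fun w => c (i :: w)

/-- Left concatenation `x_i c` of the letter `x_i` onto every word of `c`. -/
def lconcat (i : Fin 2) (c : Series) : Series := fun w =>
  match w with
  | [] => 0
  | j :: v => if j = i then c v else 0

/-- Right concatenation `p x_i` of the letter `x_i` onto every word of `p`. -/
def rconcat {R : Type*} [Zero R] (i : Fin 2) (p : Word → R) : Word → R := fun w =>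
  if w.getLast? = some i then p w.dropLast else 0

/-- The series of a single word. -/
def ind (η : Word) : Series := fun w => if w = η then 1 else 0

/-- The empty word as a series, the unit `∅` (often written `1`). -/
def one : Series := ind []

/-- The shuffle product, defined coefficientwise by the recursion
`⟨c ⧢ d, ∅⟩ = ⟨c,∅⟩⟨d,∅⟩` and `⟨c ⧢ d, x_i w⟩ = ⟨x_i⁻¹(c) ⧢ d, w⟩ + ⟨c ⧢ x_i⁻¹(d), w⟩`,
which is the bilinear (and ultrametrically continuous) extension of the recursive
shuffle product of words. -/
def shuffleFn : Series → Series → Word → ℝ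
  | c, d, [] => c [] * d []
  | c, d, i :: w => shuffleFn (lshift i c) d w + shuffleFn c (lshift i d) w

/-- The shuffle product on `ℝ⟨⟨X⟩⟩`. -/
def sh (c d : Series) : Series := shuffleFn c d

/-- The map `φ_d(x_i)` for the modified composition product:
`φ_d(x0)(e) = x0 e` and `φ_d(x1)(e) = x1 e + x0 (d ⧢ e)`. -/
def phiLetter (d : Series) (i : Fin 2) (e : Series) : Series :=
  if i = 0 then lconcat 0 e else lconcat 1 e + lconcat 0 (sh d e)

/-- `φ_d(η)`, the algebra-homomorphism extension determined by
`φ_d(x_i η) = φ_d(x_i) ∘ φ_d(η)` and `φ_d(∅) = id`. -/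
def phi (d : Series) : Word → Series → Series
  | [], e => e
  | i :: η, e => phiLetter d i (phi d η e)

/-- The modified composition product `c ∘̃ d = Σ_η ⟨c,η⟩ φ_d(η)(1)`. -/
def mcomp (c d : Series) : Series := fun w => ∑' η : Word, c η * phi d η one w

/-- The map `ψ_d(x_i)` for the composition product:
`ψ_d(x0)(e) = x0 e` and `ψ_d(x1)(e) = x0 (d ⧢ e)`. -/
def psiLetter (d : Series) (i : Fin 2) (e : Series) : Series :=
  if i = 0 then lconcat 0 e else lconcat 0 (sh d e)

/-- `ψ_d(η)`, determined by `ψ_d(x_i η) = ψ_d(x_i) ∘ ψ_d(η)` and `ψ_d(∅) = id`. -/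
def psi (d : Series) : Word → Series → Series
  | [], e => e
  | i :: η, e => psiLetter d i (psi d η e)

/-- The composition product `c ∘ d = Σ_η ⟨c,η⟩ ψ_d(η)(1)`. -/
def comp (c d : Series) : Series := fun w => ∑' η : Word, c η * psi d η one w

/-- The group operation on `ℝ⟨⟨X_δ⟩⟩ = {δ + c}`, transported to the `c`-parts:
`c_δ ∘ d_δ = δ + (d + c ∘̃ d)`. -/
def gop (c d : Series) : Series := d + mcomp c d

/-- The Ferfera series `c = Σ_{k ≥ 0} k! x1^k`. -/
def ferfera : Series := fun w =>
  if w = List.replicate w.length (1 : Fin 2) then (Nat.factorial w.length : ℝ) else 0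

/-- The degree of a word, `deg(η) = 2|η|_{x0} + |η|_{x1} + 1`. -/
def degW (η : Word) : ℕ := 2 * η.count 0 + η.count 1 + 1

/-- The output feedback Hopf algebra `H`: the free unital commutative `ℝ`-algebra on the
coordinate functions `a_η`, realized as polynomials in commuting variables indexed by words. -/
abbrev H : Type := MvPolynomial Word ℝ

/-- The coordinate function `a_η`. -/
def aw (η : Word) : H := MvPolynomial.X η

/-- Character (pointwise) evaluation of elements of `H` at a series `c`:
`(a_{η₁} ⋯ a_{η_l})(c) = ⟨c,η₁⟩ ⋯ ⟨c,η_l⟩`, extended as an algebra map. -/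
def evalS (c : Series) : H →ₐ[ℝ] ℝ := MvPolynomial.aeval c

/-- Evaluation of `H ⊗ H` at a pair of series: `(p ⊗ q)(c,d) = p(c) q(d)`. -/
def evalPair (c d : Series) : H ⊗[ℝ] H →ₗ[ℝ] ℝ :=
  (LinearMap.mul' ℝ ℝ).comp (TensorProduct.map (evalS c).toLinearMap (evalS d).toLinearMap)

/-- The counit `ε` of `H`: `ε(a_η) = 0`, `ε(1) = 1`. -/
def counit : H →ₐ[ℝ] ℝ := evalS 0

/-- The defining property of the full coproduct `Δ` of the output feedback Hopf algebra:
`Δ a_η = Δ̃ a_η + 1 ⊗ a_η` where `Δ̃ a_η (c,d) = ⟨c ∘̃ d, η⟩`, i.e.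
`(Δ a_η)(c,d) = ⟨c ∘̃ d, η⟩ + ⟨d, η⟩` for all series `c, d`; `Δ` is an algebra morphism. -/
def IsFBCoproduct (Δ : H →ₐ[ℝ] (H ⊗[ℝ] H)) : Prop :=
  ∀ (η : Word) (c d : Series), evalPair c d (Δ (aw η)) = mcomp c d η + d η

/-- `S` is an antipode for the coproduct `Δ` (with counit `ε`):
`μ ∘ (S ⊗ id) ∘ Δ = 1·ε = μ ∘ (id ⊗ S) ∘ Δ`. -/
def IsAntipode (Δ : H →ₐ[ℝ] (H ⊗[ℝ] H)) (S : H →ₗ[ℝ] H) : Prop :=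
  (∀ p : H, LinearMap.mul' ℝ H (TensorProduct.map S LinearMap.id (Δ p)) = counit p • 1) ∧
  (∀ p : H, LinearMap.mul' ℝ H (TensorProduct.map LinearMap.id S (Δ p)) = counit p • 1)

/-- The right-augmentation operator `θ̃_i`, the derivation on `H` with `θ̃_i(a_η) = a_{η x_i}`. -/
def thetaR (i : Fin 2) : Derivation ℝ H H :=
  MvPolynomial.mkDerivation ℝ fun η => aw (η ++ [i])

/-- The left-augmentation operator `θ_i`, the derivation on `H` with `θ_i(a_η) = a_{x_i η}`. -/
def thetaL (i : Fin 2) : Derivation ℝ H H :=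
  MvPolynomial.mkDerivation ℝ fun η => aw (i :: η)

/-- The multiplication operator `κ_∅(h) = h · a_∅`. -/
def kappaE : H →ₗ[ℝ] H := LinearMap.mulRight ℝ (aw [])

/-- The shuffle coefficient `⟨ξ ⧢ ν, η⟩`. -/
def shCoeff (ξ ν η : Word) : ℝ := sh (ind ξ) (ind ν) η

/-- The finite set of words of length `n`. -/
def wordsLen (n : ℕ) : Finset Word :=
  (Finset.univ : Finset (Fin n → Fin 2)).image List.ofFn

/-- The deshuffle coproduct `Δ_⧢ a_η = Σ_{ξ,ν} ⟨ξ ⧢ ν, η⟩ a_ξ ⊗ a_ν`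
(the unique coproduct satisfying `Δ_⧢ a_∅ = a_∅ ⊗ a_∅` and the coderivation recursions
with respect to the augmentation operators). -/
def deshuffle (η : Word) : H ⊗[ℝ] H :=
  ∑ k ∈ Finset.range (η.length + 1), ∑ ξ ∈ wordsLen k, ∑ ν ∈ wordsLen (η.length - k),
    shCoeff ξ ν η • (aw ξ ⊗ₜ[ℝ] aw ν)

/-- Iterated integrals: `E_∅[u](t) = 1`, `E_{x_i η}[u](t) = ∫₀ᵗ u_i(s) E_η[u](s) ds`. -/
def E (u : Fin 2 → ℝ → ℝ) : Word → ℝ → ℝ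
  | [], _ => 1
  | i :: η, t => ∫ s in (0:ℝ)..t, u i s * E u η s

end Paper

namespace Paper

/-- The coproduct `Δ̃` (on coordinate functions, `Δ̃ a_η = Δ a_η − 1 ⊗ a_η`),
as a linear map. -/
def tDelta (Δ : H →ₐ[ℝ] (H ⊗[ℝ] H)) : H →ₗ[ℝ] H ⊗[ℝ] H :=
  Δ.toLinearMap - TensorProduct.mk ℝ H H 1

end Paper

namespace Paper

section Shuffle

@[simp] lemma sh_nil (c d : Series) : sh c d [] = c [] * d [] := by
  simp [sh, shuffleFn]

lemma sh_cons (c d : Series) (i : Fin 2) (w : Word) :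
    sh c d (i :: w) = sh (lshift i c) d w + sh c (lshift i d) w := by
  simp [sh, shuffleFn]

lemma sh_comm (c d : Series) (w : Word) : sh c d w = sh d c w := by
  induction w generalizing c d with
  | nil => simp [mul_comm]
  | cons i w ih => rw [sh_cons, sh_cons, ih, ih c, add_comm]

/-- The coefficient of `w` in a shuffle product only involves words no longer than `w`. -/
lemma sh_congr_left {c c' : Series} (d : Series) {w : Word}
    (h : ∀ u : Word, u.length ≤ w.length → c u = c' u) : sh c d w = sh c' d w := by
  induction w generalizing c c' d with
  | nil => simp [h []]
  | cons i w ih =>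
    rw [sh_cons, sh_cons, ih d (c' := lshift i c'), ih (lshift i d) (c' := c')]
    · exact fun u hu => h u (hu.trans (by simp))
    · exact fun u hu => h (i :: u) (by simpa using hu)

lemma sh_sum_left {ι : Type*} (s : Finset ι) (a : ι → ℝ) (F : ι → Series) (d : Series)
    (w : Word) : sh (fun u => ∑ j ∈ s, a j * F j u) d w = ∑ j ∈ s, a j * sh (F j) d w := by
  induction w generalizing F d with
  | nil => simp [Finset.sum_mul, mul_assoc]
  | cons i w ih =>
    simp only [sh_cons, mul_add, Finset.sum_add_distrib, ← ih]
    rfl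

lemma sh_sum_right {ι : Type*} (s : Finset ι) (a : ι → ℝ) (F : ι → Series) (c : Series)
    (w : Word) : sh c (fun u => ∑ j ∈ s, a j * F j u) w = ∑ j ∈ s, a j * sh c (F j) w := by
  simp only [sh_comm c, sh_sum_left]

lemma sh_zero_left (d : Series) (w : Word) : sh 0 d w = 0 := by
  simpa [Pi.zero_def] using sh_sum_left (∅ : Finset Word) (fun _ => 0) (fun _ => 0) d w

lemma sh_zero_right (c : Series) (w : Word) : sh c 0 w = 0 := by
  rw [sh_comm, sh_zero_left]

/-- The homogeneous component of degree `k` of a series. -/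
def homog (k : ℕ) (c : Series) : Series := fun w => if w.length = k then c w else 0

lemma lshift_homog_zero (i : Fin 2) (c : Series) : lshift i (homog 0 c) = 0 := by
  ext w; simp [lshift, homog]

lemma lshift_homog_succ (i : Fin 2) (k : ℕ) (c : Series) :
    lshift i (homog (k + 1) c) = homog k (lshift i c) := by
  ext w; simp [lshift, homog]

/-- The shuffle product is graded by word length. -/
lemma sh_eq_sum_homog (c d : Series) (w : Word) :
    sh c d w = ∑ k ∈ Finset.range (w.length + 1),
      sh (homog k c) (homog (w.length - k) d) w := by
  induction w generalizing c d with
  | nil => simp [homog]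
  | cons i w ih =>
    simp only [sh_cons, Finset.sum_add_distrib, List.length_cons]
    rw [Finset.sum_range_succ', Finset.sum_range_succ _ (w.length + 1), ih, ih c]
    simp only [lshift_homog_succ, lshift_homog_zero, sh_zero_left, sh_zero_right,
      Nat.add_sub_add_right, Nat.sub_self, add_zero]
    congr 1
    refine Finset.sum_congr rfl fun k hk => ?_
    rw [Nat.succ_sub (Finset.mem_range_succ_iff.mp hk), lshift_homog_succ]

lemma mem_wordsLen {k : ℕ} {w : Word} : w ∈ wordsLen k ↔ w.length = k := by
  simp only [wordsLen, Finset.mem_image, Finset.mem_univ, true_and]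
  constructor
  · rintro ⟨f, rfl⟩
    simp
  · rintro rfl
    exact ⟨w.get, List.ofFn_get w⟩

lemma homog_eq_sum (k : ℕ) (c : Series) :
    homog k c = fun w => ∑ ξ ∈ wordsLen k, c ξ * ind ξ w := by
  ext w
  simp [homog, ind, mem_wordsLen]

lemma sum_shCoeff (c d : Series) (η : Word) :
    ∑ k ∈ Finset.range (η.length + 1), ∑ ξ ∈ wordsLen k, ∑ ν ∈ wordsLen (η.length - k),
      shCoeff ξ ν η * (c ξ * d ν) = sh c d η := by
  rw [sh_eq_sum_homog]
  refine Finset.sum_congr rfl fun k _ => ?_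
  rw [homog_eq_sum, homog_eq_sum, sh_sum_left]
  refine Finset.sum_congr rfl fun ξ _ => ?_
  rw [sh_sum_right, Finset.mul_sum]
  refine Finset.sum_congr rfl fun ν _ => ?_
  rw [shCoeff]
  ring

end Shuffle

section Composition

/-- The finite set of words of length at most `n`. -/
def wordsLE : ℕ → Finset Word
  | 0 => {[]}
  | n + 1 => insert [] ((wordsLE n).image (List.cons 0) ∪ (wordsLE n).image (List.cons 1))

lemma mem_wordsLE {n : ℕ} {w : Word} : w ∈ wordsLE n ↔ w.length ≤ n := by
  induction n generalizing w with
  | zero => simp [wordsLE]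
  | succ n ih =>
    cases w with
    | nil => simp [wordsLE]
    | cons i w => fin_cases i <;> simp [wordsLE, ih]

lemma sum_wordsLE_succ (n : ℕ) (f : Word → ℝ) :
    ∑ η ∈ wordsLE (n + 1), f η =
      f [] + (∑ η ∈ wordsLE n, f (0 :: η) + ∑ η ∈ wordsLE n, f (1 :: η)) := by
  rw [wordsLE, Finset.sum_insert (by simp), Finset.sum_union, Finset.sum_image (by simp),
    Finset.sum_image (by simp)]
  rw [Finset.disjoint_left]
  simp only [Finset.mem_image]
  rintro _ ⟨a, -, rfl⟩ ⟨b, -, hb⟩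
  simp at hb

lemma phi_nil_one_cons (d : Series) (i : Fin 2) (w : Word) : phi d [] one (i :: w) = 0 := by
  simp [phi, one, ind]

lemma phi_cons_nil (d e : Series) (i : Fin 2) (η : Word) : phi d (i :: η) e [] = 0 := by
  fin_cases i <;> simp [phi, phiLetter, lconcat]

lemma phi_zero_cons_zero (d e : Series) (η w : Word) :
    phi d (0 :: η) e (0 :: w) = phi d η e w := by
  simp [phi, phiLetter, lconcat]

lemma phi_zero_cons_one (d e : Series) (η w : Word) : phi d (0 :: η) e (1 :: w) = 0 := by
  simp [phi, phiLetter, lconcat]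

lemma phi_one_cons_zero (d e : Series) (η w : Word) :
    phi d (1 :: η) e (0 :: w) = sh d (phi d η e) w := by
  simp [phi, phiLetter, lconcat]

lemma phi_one_cons_one (d e : Series) (η w : Word) :
    phi d (1 :: η) e (1 :: w) = phi d η e w := by
  simp [phi, phiLetter, lconcat]

lemma phi_eq_zero (d e : Series) {η w : Word} (h : w.length < η.length) :
    phi d η e w = 0 := by
  induction η generalizing w with
  | nil => simp at h
  | cons i η ih =>
    cases w with
    | nil => exact phi_cons_nil ..
    | cons j w =>
      replace h : w.length < η.length := by simpa using h
      fin_cases i <;> fin_cases j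
      · exact (phi_zero_cons_zero ..).trans (ih h)
      · exact phi_zero_cons_one ..
      · refine (phi_one_cons_zero ..).trans ?_
        rw [sh_comm, sh_congr_left (c' := 0) d fun u hu => ih (hu.trans_lt h), sh_zero_left]
      · exact (phi_one_cons_one ..).trans (ih h)

lemma mcomp_eq_sum (c d : Series) {w : Word} {n : ℕ} (h : w.length ≤ n) :
    mcomp c d w = ∑ η ∈ wordsLE n, c η * phi d η one w := by
  refine tsum_eq_sum fun η hη => ?_
  rw [mem_wordsLE, not_le] at hη
  rw [phi_eq_zero d one (h.trans_lt hη), mul_zero]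

lemma mcomp_nil (c d : Series) : mcomp c d [] = c [] := by
  rw [mcomp_eq_sum c d (n := 0) (by simp)]
  simp [wordsLE, phi, one, ind]

lemma mcomp_cons_one (c d : Series) (w : Word) :
    mcomp c d (1 :: w) = mcomp (lshift 1 c) d w := by
  rw [mcomp_eq_sum c d (n := w.length + 1) (by simp), mcomp_eq_sum _ d le_rfl,
    sum_wordsLE_succ]
  simp [phi_nil_one_cons, phi_zero_cons_one, phi_one_cons_one, lshift]

lemma mcomp_cons_zero (c d : Series) (w : Word) :
    mcomp c d (0 :: w) = mcomp (lshift 0 c) d w + sh (mcomp (lshift 1 c) d) d w := by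
  rw [sh_congr_left d fun u hu => mcomp_eq_sum (lshift 1 c) d hu, sh_sum_left,
    mcomp_eq_sum c d (n := w.length + 1) (by simp), mcomp_eq_sum _ d le_rfl,
    sum_wordsLE_succ]
  simp [phi_nil_one_cons, phi_zero_cons_zero, phi_one_cons_zero, lshift, sh_comm d]

end Composition

section Evaluation

@[simp] lemma evalS_aw (c : Series) (η : Word) : evalS c (aw η) = c η := by
  simp [evalS, aw]

@[simp] lemma thetaL_aw (i : Fin 2) (η : Word) : thetaL i (aw η) = aw (i :: η) := by
  simp [thetaL, aw]

@[simp] lemma evalPair_tmul (c d : Series) (p q : H) :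
    evalPair c d (p ⊗ₜ q) = evalS c p * evalS d q := by
  simp [evalPair]

lemma eval_tensorEquivSum (c d : Series) (T : H ⊗[ℝ] H) :
    MvPolynomial.eval (Sum.elim c d) (MvPolynomial.tensorEquivSum ℝ Word Word ℝ T) =
      evalPair c d T := by
  have h : (MvPolynomial.aeval (R := ℝ) (Sum.elim c d)).comp
        (MvPolynomial.tensorEquivSum ℝ Word Word ℝ).toAlgHom =
      (Algebra.TensorProduct.lmul' ℝ).comp (Algebra.TensorProduct.map (evalS c) (evalS d)) := by
    ext i <;> simp [evalS]
  have h' := DFunLike.congr_fun h T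
  have h'' : (Algebra.TensorProduct.lmul' ℝ).comp
      (Algebra.TensorProduct.map (evalS c) (evalS d)) T = evalPair c d T := by
    induction T with
    | zero => simp
    | tmul p q => simp
    | add S T hS hT => simp_all
  rw [← h'', ← h']
  simp [MvPolynomial.aeval_eq_eval]

/-- Elements of `H ⊗ H` are determined by their values on pairs of series. -/
lemma evalPair_ext {S T : H ⊗[ℝ] H} (h : ∀ c d, evalPair c d S = evalPair c d T) : S = T := by
  apply (MvPolynomial.tensorEquivSum ℝ Word Word ℝ).injective
  refine MvPolynomial.funext fun x => ?_
  rw [← Sum.elim_comp_inl_inr x, eval_tensorEquivSum, eval_tensorEquivSum, h]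

lemma exists_evalS_eq_sh {F G : Series → Series}
    (hF : ∀ w, ∃ p : H, ∀ d, evalS d p = F d w) (hG : ∀ w, ∃ p : H, ∀ d, evalS d p = G d w)
    (w : Word) : ∃ p : H, ∀ d, evalS d p = sh (F d) (G d) w := by
  induction w generalizing F G with
  | nil =>
    obtain ⟨p, hp⟩ := hF []
    obtain ⟨q, hq⟩ := hG []
    exact ⟨p * q, by simp [hp, hq]⟩
  | cons i w ih =>
    obtain ⟨p, hp⟩ := ih (F := fun d => lshift i (F d)) (fun u => hF (i :: u)) hG
    obtain ⟨q, hq⟩ := ih (G := fun d => lshift i (G d)) hF (fun u => hG (i :: u))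
    exact ⟨p + q, by simp [hp, hq, sh_cons]⟩

/-- The coefficients of `φ_d(η)(1)` are polynomial functions of `d`. -/
lemma exists_evalS_eq_phi (η w : Word) : ∃ p : H, ∀ d, evalS d p = phi d η one w := by
  induction η generalizing w with
  | nil => exact ⟨MvPolynomial.C (one w), by simp [evalS, phi]⟩
  | cons i η ih =>
    cases w with
    | nil => exact ⟨0, by simp [phi_cons_nil]⟩
    | cons j w =>
      fin_cases i <;> fin_cases j
      · simpa [phi_zero_cons_zero] using ih w
      · exact ⟨0, by simp [phi_zero_cons_one]⟩
      · simpa [phi_one_cons_zero] using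
          exists_evalS_eq_sh (F := id) (fun u => ⟨aw u, by simp⟩) ih w
      · simpa [phi_one_cons_one] using ih w

lemma evalPair_tDelta {Δ : H →ₐ[ℝ] (H ⊗[ℝ] H)} (hΔ : IsFBCoproduct Δ) (c d : Series)
    (η : Word) : evalPair c d (tDelta Δ (aw η)) = mcomp c d η := by
  simp [tDelta, hΔ η c d]

/-- `Δ̃ a_w` lies in `V ⊗ H`. -/
lemma exists_tDelta_eq_sum {Δ : H →ₐ[ℝ] (H ⊗[ℝ] H)} (hΔ : IsFBCoproduct Δ) (w : Word) :
    ∃ P : Word → H, tDelta Δ (aw w) = ∑ η ∈ wordsLE w.length, aw η ⊗ₜ P η := by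
  choose P hP using fun η => exists_evalS_eq_phi η w
  refine ⟨P, evalPair_ext fun c d => ?_⟩
  simp [evalPair_tDelta hΔ, mcomp_eq_sum c d le_rfl, hP]

lemma evalPair_map_thetaL {Δ : H →ₐ[ℝ] (H ⊗[ℝ] H)} (hΔ : IsFBCoproduct Δ) (c d : Series)
    (i : Fin 2) (η : Word) :
    evalPair c d (TensorProduct.map (thetaL i).toLinearMap LinearMap.id (tDelta Δ (aw η))) =
      mcomp (lshift i c) d η := by
  rw [← evalPair_tDelta hΔ]
  obtain ⟨P, hP⟩ := exists_tDelta_eq_sum hΔ η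
  simp [hP, lshift]

lemma evalPair_map_thetaL_mul {Δ : H →ₐ[ℝ] (H ⊗[ℝ] H)} (hΔ : IsFBCoproduct Δ)
    (c d : Series) (i : Fin 2) (ξ ν : Word) :
    evalPair c d (TensorProduct.map (thetaL i).toLinearMap (LinearMap.mul' ℝ H)
      (TensorProduct.assoc ℝ H H H (tDelta Δ (aw ξ) ⊗ₜ aw ν))) =
      mcomp (lshift i c) d ξ * d ν := by
  rw [← evalPair_tDelta hΔ]
  obtain ⟨P, hP⟩ := exists_tDelta_eq_sum hΔ ξ
  simp [hP, lshift, TensorProduct.sum_tmul, Finset.sum_mul, mul_assoc]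

end Evaluation

end Paper

open Paper in
/-- The coproduct `Δ̃` of the output feedback Hopf algebra satisfies:
(1) `Δ̃ a_∅ = a_∅ ⊗ 1`;
(2) `Δ̃ ∘ θ_1 = (θ_1 ⊗ id) ∘ Δ̃`;
(3) `Δ̃ ∘ θ_0 = (θ_0 ⊗ id) ∘ Δ̃ + (θ_1 ⊗ μ) ∘ (Δ̃ ⊗ id) ∘ Δ_⧢`,
where `id` is the identity map on `H` and `μ` the product of `H` (the identities being
stated on the coordinate functions `a_η`, on which `Δ̃` is defined). -/
theorem tilde_coproduct_inductions
    (Δ : H →ₐ[ℝ] (H ⊗[ℝ] H)) (hΔ : IsFBCoproduct Δ) :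
    (tDelta Δ (aw []) = aw [] ⊗ₜ[ℝ] (1 : H)) ∧
    (∀ η : Word, tDelta Δ (aw ((1 : Fin 2) :: η)) =
      TensorProduct.map (thetaL 1).toLinearMap LinearMap.id (tDelta Δ (aw η))) ∧
    (∀ η : Word, tDelta Δ (aw ((0 : Fin 2) :: η)) =
      TensorProduct.map (thetaL 0).toLinearMap LinearMap.id (tDelta Δ (aw η))
      + TensorProduct.map (thetaL 1).toLinearMap (LinearMap.mul' ℝ H)
          (TensorProduct.assoc ℝ H H H
            (TensorProduct.map (tDelta Δ) LinearMap.id (deshuffle η)))) := by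
  refine ⟨evalPair_ext fun c d => ?_, fun η => evalPair_ext fun c d => ?_,
    fun η => evalPair_ext fun c d => ?_⟩
  · simp [evalPair_tDelta hΔ, mcomp_nil]
  · rw [evalPair_tDelta hΔ, evalPair_map_thetaL hΔ, mcomp_cons_one]
  · rw [map_add, evalPair_tDelta hΔ, evalPair_map_thetaL hΔ, mcomp_cons_zero, ← sum_shCoeff]
    simp [deshuffle, evalPair_map_thetaL_mul hΔ]
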